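/- Let ω = e^{2πi/3} and let M₄ be the 4-mode tensor on ℂ² given by M₄ = (e₁⊗e₁⊗e₂⊗e₂ + e₂⊗e₂⊗e₁⊗e₁ + ω(e₂⊗e₁⊗e₂⊗e₁ + e₁⊗e₂⊗e₁⊗e₂) + ω²(e₂⊗e₁⊗e₁⊗e₂ + e₁⊗e₂⊗e₂⊗e₁))/√6, where e₁,e₂ is the standard basis of ℂ². Then ‖M₄‖_{∞,ℂ} = √2/3, and consequently β(2^{×4},ℂ) = √2/3 and α(2^{×4},ℂ) = 3/√2; in particular M₄ is a 4-qubit state of minimal spectral norm (a maximally entangled 4-qubit state). -/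

import Mathlib

noncomputable section


/-- The Euclidean norm of a vector in `𝕜^k`. -/
def vnorm {𝕜 : Type*} [RCLike 𝕜] {k : ℕ} (x : Fin k → 𝕜) : ℝ :=
  Real.sqrt (∑ i, ‖x i‖ ^ 2)

/-- The rank-one tensor `x₁ ⊗ ⋯ ⊗ x_d` on `𝕜^n`. -/
def rankOne {𝕜 : Type*} [RCLike 𝕜] {d n : ℕ} (x : Fin d → Fin n → 𝕜) :
    (Fin d → Fin n) → 𝕜 :=
  fun i => ∏ j, x j (i j)

/-- The standard inner product `⟨T, Y⟩ = ∑ tᵢ · conj yᵢ` of tensors. -/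
def tinner {𝕜 : Type*} [RCLike 𝕜] {d n : ℕ} (T Y : (Fin d → Fin n) → 𝕜) : 𝕜 :=
  ∑ i, T i * (starRingEnd 𝕜) (Y i)

/-- The Hilbert–Schmidt norm of a tensor. -/
def hsNorm {𝕜 : Type*} [RCLike 𝕜] {d n : ℕ} (T : (Fin d → Fin n) → 𝕜) : ℝ :=
  Real.sqrt (∑ i, ‖T i‖ ^ 2)

/-- The spectral norm of a tensor:
`max {|⟨T, x₁⊗⋯⊗x_d⟩| : ‖x_j‖ = 1 for all j}`. -/
def specNorm {𝕜 : Type*} [RCLike 𝕜] {d n : ℕ} (T : (Fin d → Fin n) → 𝕜) : ℝ :=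
  sSup {r : ℝ | ∃ x : Fin d → Fin n → 𝕜, (∀ j, vnorm (x j) = 1) ∧
    r = ‖tinner T (rankOne x)‖}

/-- The nuclear norm of a tensor:
`min {∑ᵢ ∏ⱼ ‖x_{i,j}‖ : T = ∑ᵢ x_{i,1}⊗⋯⊗x_{i,d}}`. -/
def nucNorm {𝕜 : Type*} [RCLike 𝕜] {d n : ℕ} (T : (Fin d → Fin n) → 𝕜) : ℝ :=
  sInf {r : ℝ | ∃ (m : ℕ) (x : Fin m → Fin d → Fin n → 𝕜),
    T = (∑ i, rankOne (x i)) ∧ r = ∑ i, ∏ j, vnorm (x i j)}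

/-- `α(n^{×d}, 𝕜)`. -/
def alphaN (𝕜 : Type*) [RCLike 𝕜] (d n : ℕ) : ℝ :=
  sSup {r : ℝ | ∃ T : (Fin d → Fin n) → 𝕜, hsNorm T = 1 ∧ r = nucNorm T}

/-- `β(n^{×d}, 𝕜)`. -/
def betaN (𝕜 : Type*) [RCLike 𝕜] (d n : ℕ) : ℝ :=
  sInf {r : ℝ | ∃ T : (Fin d → Fin n) → 𝕜, hsNorm T = 1 ∧ r = specNorm T}

/-- `ω = e^{2πi/3}`. -/
def om : ℂ := Complex.exp (2 * Real.pi * Complex.I / 3)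

/-- The Higuchi–Sudbery tensor `M₄` on `ℂ²`. -/
def M4 : (Fin 4 → Fin 2) → ℂ := fun i =>
  ((if i 0 = 0 ∧ i 1 = 0 ∧ i 2 = 1 ∧ i 3 = 1 then (1 : ℂ) else 0) +
   (if i 0 = 1 ∧ i 1 = 1 ∧ i 2 = 0 ∧ i 3 = 0 then (1 : ℂ) else 0) +
   om * ((if i 0 = 1 ∧ i 1 = 0 ∧ i 2 = 1 ∧ i 3 = 0 then (1 : ℂ) else 0) +
         (if i 0 = 0 ∧ i 1 = 1 ∧ i 2 = 0 ∧ i 3 = 1 then (1 : ℂ) else 0)) +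
   om ^ 2 * ((if i 0 = 1 ∧ i 1 = 0 ∧ i 2 = 0 ∧ i 3 = 1 then (1 : ℂ) else 0) +
             (if i 0 = 0 ∧ i 1 = 1 ∧ i 2 = 1 ∧ i 3 = 0 then (1 : ℂ) else 0))) /
    (Real.sqrt 6 : ℂ)

open Complex in
lemma root_unit (s0 s1 s2 : ℂ) : ∃ x y : ℂ, normSq x + normSq y = 1 ∧
    s0 * x^2 + 2 * s1 * x * y + s2 * y^2 = 0 := by
  obtain ⟨x, y, hne, h⟩ : ∃ x y : ℂ, 0 < normSq x + normSq y ∧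
      s0 * x^2 + 2 * s1 * x * y + s2 * y^2 = 0 := by
    by_cases h0 : s0 = 0
    · exact ⟨1, 0, by simp, by simp [h0]⟩
    · obtain ⟨r, hr⟩ := IsAlgClosed.exists_pow_nat_eq (s1^2 - s0*s2) (n := 2) (by norm_num)
      refine ⟨-s1 + r, s0, ?_, ?_⟩
      · have := normSq_pos.2 h0
        have := normSq_nonneg (-s1 + r)
        linarith
      · linear_combination s0 * hr
  set n := normSq x + normSq y
  have hs : Real.sqrt n ^ 2 = n := Real.sq_sqrt hne.le
  have hs0 : (0:ℝ) < Real.sqrt n := Real.sqrt_pos.2 hne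
  refine ⟨((Real.sqrt n)⁻¹ : ℝ) * x, ((Real.sqrt n)⁻¹ : ℝ) * y, ?_, ?_⟩
  · rw [normSq_mul, normSq_mul, normSq_ofReal, ← mul_add]
    change _ * n = 1
    field_simp
    exact hs.symm
  · linear_combination (((Real.sqrt n)⁻¹ : ℝ) : ℂ)^2 * h

open Complex in
lemma unit_sq (c : ℂ) : ∃ e : ℂ, normSq e = 1 ∧ c = (Real.sqrt (normSq c) : ℝ) * e^2 := by
  refine ⟨exp ((arg c / 2 : ℝ) * I), ?_, ?_⟩
  · rw [normSq_eq_norm_sq, norm_exp_ofReal_mul_I]; norm_num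
  · rw [← exp_nat_mul]
    have : ((2:ℕ):ℂ) * (((arg c / 2 : ℝ):ℂ) * I) = arg c * I := by push_cast; ring
    rw [this, normSq_eq_norm_sq, Real.sqrt_sq (norm_nonneg _), norm_mul_exp_arg_mul_I]

lemma sign_choice (t a b : ℝ) (ha : |a| ≤ t) (hb : |b| ≤ t) :
    (a + b)^2 ≤ t^2 ∨ (b - a)^2 ≤ t^2 := by
  obtain ⟨a1, a2⟩ := abs_le.1 ha
  obtain ⟨b1, b2⟩ := abs_le.1 hb
  rcases le_total 0 a with h | h <;> rcases le_total 0 b with h' | h'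
  · right; exact sq_le_sq' (by linarith) (by linarith)
  · left; exact sq_le_sq' (by linarith) (by linarith)
  · left; exact sq_le_sq' (by linarith) (by linarith)
  · right; exact sq_le_sq' (by linarith) (by linarith)

/-- real ellipse step -/
lemma ellipse (t c0 c2 u v : ℝ) (ht : 0 ≤ t) (h0 : 0 ≤ c0) (h2 : 0 ≤ c2) (h0' : c0 ≤ t) (h2' : c2 ≤ t)
    (h1 : u^2 + v^2 ≤ t^2) :
    ∃ c s : ℝ, c^2 + s^2 = 1 ∧ ((c0+c2)*c + u)^2 + ((c2-c0)*s+v)^2 ≤ t^2 := by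
  by_cases hu : |u| < c0 + c2
  · have hp : 0 < c0 + c2 := lt_of_le_of_lt (abs_nonneg _) hu
    have hle : (u/(c0+c2))^2 ≤ 1 := by
      rw [div_pow, div_le_one (by positivity)]
      exact sq_le_sq' (by linarith [neg_abs_le u]) (by linarith [le_abs_self u])
    set s := Real.sqrt (1 - (u/(c0+c2))^2)
    have hs : s^2 = 1 - (u/(c0+c2))^2 := Real.sq_sqrt (by linarith)
    have hs0 : 0 ≤ s := Real.sqrt_nonneg _
    have hs1 : s ≤ 1 := by nlinarith [sq_nonneg (u/(c0+c2))]
    have hv : |v| ≤ t := abs_le_of_sq_le_sq (by nlinarith) ht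
    have hd : |(c2-c0)*s| ≤ t := by
      rw [abs_mul, abs_of_nonneg hs0]
      have : |c2-c0| ≤ t := abs_le.2 ⟨by linarith, by linarith⟩
      nlinarith [abs_nonneg (c2-c0)]
    have hz : (c0+c2)*(-(u/(c0+c2))) + u = 0 := by field_simp; ring
    rcases sign_choice t _ _ hd hv with hh | hh
    · exact ⟨-(u/(c0+c2)), s, by rw [neg_sq, hs]; ring, by rw [hz]; linarith⟩
    · exact ⟨-(u/(c0+c2)), -s, by rw [neg_sq, neg_sq, hs]; ring, by
        rw [hz, mul_neg, neg_add_eq_sub]; linarith⟩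
  · push Not at hu
    rcases le_total 0 u with h | h
    · rw [abs_of_nonneg h] at hu
      exact ⟨-1, 0, by norm_num, by nlinarith⟩
    · rw [abs_of_nonpos h] at hu
      exact ⟨1, 0, by norm_num, by nlinarith⟩

open Complex in
lemma phase (t : ℝ) (c0 c1 c2 : ℂ) (ht : 0 ≤ t) (h0 : normSq c0 ≤ t^2) (h1 : normSq c1 ≤ t^2)
    (h2 : normSq c2 ≤ t^2) :
    ∃ w : ℂ, normSq w = 1 ∧ normSq (c0 + c1 * w + c2 * w^2) ≤ t^2 := by
  obtain ⟨e0, he0, hc0⟩ := unit_sq c0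
  obtain ⟨e2, he2, hc2⟩ := unit_sq c2
  set r0 := Real.sqrt (normSq c0)
  set r2 := Real.sqrt (normSq c2)
  set k := c1 * star e0 * star e2 with hk
  have hkn : normSq k ≤ t^2 := by
    rw [hk, normSq_mul, normSq_mul]
    simp only [star_def, normSq_conj, he0, he2, mul_one, h1]
  obtain ⟨c, s, hcs, hle⟩ := ellipse t r0 r2 k.re k.im ht (Real.sqrt_nonneg _) (Real.sqrt_nonneg _)
    ((Real.sqrt_le_left ht).2 h0) ((Real.sqrt_le_left ht).2 h2) (by rw [normSq_apply] at hkn; nlinarith)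
  have e0m : e0 * star e0 = 1 := by rw [star_def, mul_conj, he0]; simp
  have e2m : e2 * star e2 = 1 := by rw [star_def, mul_conj, he2]; simp
  set o : ℂ := ⟨c, s⟩ with ho
  have hon : normSq o = 1 := by rw [normSq_apply]; simp [ho]; nlinarith
  have om : o * star o = 1 := by rw [star_def, mul_conj, hon]; simp
  refine ⟨o * e0 * star e2, ?_, ?_⟩
  · rw [normSq_mul, normSq_mul, star_def, normSq_conj, hon, he0, he2]; norm_num
  · have key : c0 + c1 * (o * e0 * star e2) + c2 * (o * e0 * star e2)^2
       = e0^2 * o * (r0 * star o + r2 * o + k) := by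
      rw [hc2, hk]
      nth_rewrite 1 [hc0]
      linear_combination (- e0^2 * r0) * om - c1 * o * e0 * star e2 * e0m +
        r2 * o^2 * e0^2 * (e2 * star e2 + 1) * e2m
    rw [key, normSq_mul, normSq_mul, hon, pow_two e0, normSq_mul, he0, normSq_apply]
    have hre : (r0 * star o + r2 * o + k).re = (r0+r2)*c + k.re := by
      simp [ho]; ring
    have him : (r0 * star o + r2 * o + k).im = (r2-r0)*s + k.im := by
      simp [ho]; ring
    rw [hre, him]; nlinarith

open Complex in
lemma core_t (p q m : ℝ) (s0 s1 s2 : ℂ) (hp : 0 < p) (hq : 0 < q) (hp5 : 5/9 < p)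
    (h0 : normSq s0 ≤ p^2) (h2 : normSq s2 ≤ q^2) (h1 : p * normSq s1 ≤ q * (8/9 - p)^2) (hp8 : p < 8/9)
    (hm : 1/3 ≤ m) (hm1 : m ≤ 1) (hpq : 8 * (2*m*q + p*(1-m)^2) ≤ 18*p*q) :
    ∃ x y : ℂ, 0 < normSq x + normSq y ∧ (p * normSq x + q * normSq y < 8/9 * (normSq x + normSq y) →
      normSq (s0 * x^2 + 2 * s1 * x * y + s2 * y^2) ≤
      16/9 * (normSq x + normSq y) * (p * normSq x + q * normSq y - 4/9 * (normSq x + normSq y))) := by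
  set t := 2*m/(1+m^2) with ht
  have hmp : 0 < 1 + m^2 := by positivity
  have htm : t * (1+m^2) = 2*m := by rw [ht]; field_simp
  have ht3 : 3/5 ≤ t := by rw [ht, le_div_iff₀ hmp]; nlinarith
  have ht1 : t ≤ 1 := by rw [ht, div_le_one hmp]; nlinarith [sq_nonneg (m-1)]
  have hu : 0 < t/p := by positivity
  have hw : 0 ≤ (1-t)/q := div_nonneg (by linarith) hq.le
  set u := t/p with hudef
  set w := (1-t)/q with hwdef
  have hup : p * u = t := by rw [hudef]; field_simp
  have hwq : q * w = 1 - t := by rw [hwdef]; field_simp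
  set a := Real.sqrt u
  set b := Real.sqrt w
  have ha : a * a = u := Real.mul_self_sqrt hu.le
  have hb : b * b = w := Real.mul_self_sqrt hw
  obtain ⟨z, hz, hle⟩ := phase t (s0 * (a:ℂ)^2) (2 * s1 * a * b) (s2 * (b:ℂ)^2) (by linarith)
    (by
      rw [normSq_mul, pow_two, normSq_mul, normSq_ofReal, ha, ← hup]
      nlinarith [mul_pos hu hu])
    (by
      rw [normSq_mul, normSq_mul, normSq_mul, normSq_ofReal, normSq_ofReal, ha, hb]
      have h2' : normSq (2:ℂ) = 4 := by norm_num [normSq_apply]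
      rw [h2']
      -- 4 |s1|^2 u w ≤ t^2
      have e1 : p^2 * (4 * normSq s1 * u * w) ≤ 4 * (8/9-p)^2 * t * (1-t) := by
        have : p^2 * (4 * normSq s1 * u * w) = 4 * (p * normSq s1) * (t * w) := by rw [← hup]; ring
        rw [this]
        have : 4 * (8/9-p)^2 * t * (1-t) = 4 * (q * (8/9-p)^2) * (t * w) := by rw [← hwq]; ring
        rw [this]
        have : 0 ≤ t * w := by positivity
        nlinarith
      have e2 : (8/9-p)^2 ≤ 9/25 * p^2 := by nlinarith
      have e3 : 4 * (8/9-p)^2 * t * (1-t) ≤ p^2 * t^2 := by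
        have : 4 * (8/9-p)^2 * t * (1-t) ≤ 4 * (9/25 * p^2) * t * (1-t) := by
          have : 0 ≤ t * (1-t) := mul_nonneg (by linarith) (by linarith)
          nlinarith
        have : 4 * (9/25) * (1-t) ≤ t := by linarith
        have h3 : 0 ≤ p^2 * t := by positivity
        have h4 := mul_le_mul_of_nonneg_left this h3
        linarith
      have : 0 < p^2 := by positivity
      exact le_of_mul_le_mul_left (e1.trans e3) this)
    (by
      rw [normSq_mul, pow_two, normSq_mul, normSq_ofReal, hb]
      have : normSq s2 * (w*w) ≤ (q*w)^2 := by nlinarith [mul_nonneg hw hw]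
      rw [hwq] at this
      nlinarith)
  have hx : normSq (a:ℂ) = u := by rw [normSq_ofReal, ha]
  have hy : normSq ((b:ℂ) * z) = w := by rw [normSq_mul, normSq_ofReal, hb, hz, mul_one]
  refine ⟨a, b * z, by rw [hx, hy]; linarith, ?_⟩
  rw [hx, hy]
  have e : s0 * (a:ℂ)^2 + 2 * s1 * a * (b * z) + s2 * (b * z)^2 =
    s0 * (a:ℂ)^2 + 2 * s1 * a * b * z + s2 * (b:ℂ)^2 * z^2 := by ring
  rw [e, hup, hwq]
  intro hlt
  refine hle.trans ?_
  set n := u + w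
  have hn : 8/9 * n * (1+m^2) ≤ 2 := by
    have : p*q*n*(1+m^2) = 2*m*q + p*(1-m)^2 := by
      have : p*q*n = q * (p*u) + p * (q*w) := by simp only [n]; ring
      rw [this, hup, hwq]
      linear_combination (q-p) * htm
    have hpq' : 0 < p*q := by positivity
    have : p*q*(8/9 * n * (1+m^2)) ≤ p*q*2 := by
      have e9 : p*q*(8/9 * n * (1+m^2)) = 8/9 * (p*q*n*(1+m^2)) := by ring
      rw [e9, this]; linarith
    exact le_of_mul_le_mul_left this hpq'
  have h8 : 1 < 8/9*n := by linarith
  have hsq : t^2 + ((1-m^2)/(1+m^2))^2 = 1 := by rw [ht]; field_simp; ring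
  have hr : 8/9*n - 1 ≤ (1-m^2)/(1+m^2) := by rw [le_div_iff₀ hmp]; linarith
  have h9 := pow_le_pow_left₀ (by linarith : 0 ≤ 8/9*n - 1) hr 2
  have h10 : t + (1 - t) - 4/9 * n = 1 - 4/9 * n := by ring
  rw [h10]
  linarith

open Complex in
lemma core (p q : ℝ) (s0 s1 s2 : ℂ) (hpq : p + q = 1) (hle : q ≤ p) (hq0 : 0 ≤ q)
    (h2 : normSq s2 ≤ q^2) (h01 : q * normSq s0 + p * normSq s1 ≤ p^2 * q)
    (h : ∀ x y : ℂ, 0 < normSq x + normSq y →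
      p * normSq x + q * normSq y < 8/9 * (normSq x + normSq y) ∧
      16/9 * (normSq x + normSq y) * (p * normSq x + q * normSq y - 4/9 * (normSq x + normSq y)) <
      normSq (s0 * x^2 + 2 * s1 * x * y + s2 * y^2)) : False := by
  have h10 := h 1 0 (by simp)
  simp at h10
  obtain ⟨hp8, hs0⟩ := h10
  have hq : 0 < q := by linarith
  have hp : 0 < p := by linarith
  rcases le_or_gt p (5/9) with hp5 | hp5
  · obtain ⟨x, y, hn, hr⟩ := root_unit s0 s1 s2
    have := (h x y (by rw [hn]; norm_num)).2
    rw [hr, hn, map_zero] at this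
    nlinarith [normSq_nonneg x, normSq_nonneg y]
  have h0 : normSq s0 ≤ p^2 := by
    have : 0 ≤ p * normSq s1 := mul_nonneg hp.le (normSq_nonneg _)
    exact le_of_mul_le_mul_left (by linarith : q * normSq s0 ≤ q * p^2) hq
  have h1 : p * normSq s1 ≤ q * (8/9 - p)^2 := by nlinarith
  obtain ⟨m, hm, hm1, hmm⟩ : ∃ m : ℝ, 1/3 ≤ m ∧ m ≤ 1 ∧ 8 * (2*m*q + p*(1-m)^2) ≤ 18*p*q := by
    have hq' : q = 1 - p := by linarith
    rcases le_or_gt p (3/5) with h3 | h3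
    · refine ⟨1/3, le_rfl, by norm_num, ?_⟩
      rw [hq']; nlinarith
    · refine ⟨(2*p-1)/p, by rw [le_div_iff₀ hp]; linarith, by rw [div_le_one hp]; linarith, ?_⟩
      have : 2*((2*p-1)/p)*q + p*(1-(2*p-1)/p)^2 = q*(3*p-1)/p := by
        rw [hq']; field_simp; ring
      rw [this, mul_div_assoc', div_le_iff₀ hp]
      have := mul_nonneg hq.le (sq_nonneg (3*p-2))
      nlinarith
  obtain ⟨x, y, hpos, hxy⟩ := core_t p q m s0 s1 s2 hp hq hp5 h0 h2 h1 hp8 hm hm1 hmm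
  have := h x y hpos
  exact absurd (hxy this.1) (not_le.2 this.2)

open Complex in
lemma mat2 (L : ℝ) (hL : 0 ≤ L) (m : Fin 2 → Fin 2 → ℂ)
    (h : ∀ y0 y1 z0 z1 : ℂ, normSq (y0 * (m 0 0 * z0 + m 0 1 * z1) + y1 * (m 1 0 * z0 + m 1 1 * z1)) ≤
      L * (normSq y0 + normSq y1) * (normSq z0 + normSq z1)) :
    normSq (m 0 0) + normSq (m 0 1) + normSq (m 1 0) + normSq (m 1 1) ≤ 2 * L ∧
    0 ≤ L^2 - L * (normSq (m 0 0) + normSq (m 0 1) + normSq (m 1 0) + normSq (m 1 1)) +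
      normSq (m 0 0 * m 1 1 - m 0 1 * m 1 0) := by
  have hz : ∀ z0 z1 : ℂ, normSq (m 0 0 * z0 + m 0 1 * z1) + normSq (m 1 0 * z0 + m 1 1 * z1) ≤
      L * (normSq z0 + normSq z1) := by
    intro z0 z1
    have := h (star (m 0 0 * z0 + m 0 1 * z1)) (star (m 1 0 * z0 + m 1 1 * z1)) z0 z1
    generalize m 0 0 * z0 + m 0 1 * z1 = r0 at *
    generalize m 1 0 * z0 + m 1 1 * z1 = r1 at *
    have e : star r0 * r0 + star r1 * r1 = ((normSq r0 + normSq r1 : ℝ) : ℂ) := by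
      rw [star_def, ← normSq_eq_conj_mul_self, ← normSq_eq_conj_mul_self]; push_cast; rfl
    rw [e, normSq_ofReal, star_def, normSq_conj, normSq_conj] at this
    have hn0 : 0 ≤ L * (normSq z0 + normSq z1) :=
      mul_nonneg hL (add_nonneg (normSq_nonneg _) (normSq_nonneg _))
    rcases (add_nonneg (normSq_nonneg r0) (normSq_nonneg r1)).eq_or_lt with h0 | h0
    · rw [← h0]; exact hn0
    · refine le_of_mul_le_mul_left ?_ h0
      linarith
  set k := star (m 0 1) * m 0 0 + star (m 1 1) * m 1 0 with hk
  set a := L - normSq (m 0 0) - normSq (m 1 0) with ha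
  set d := L - normSq (m 0 1) - normSq (m 1 1) with hd
  have ha0 : 0 ≤ a := by have := hz 1 0; simp at this; linarith
  have hd0 : 0 ≤ d := by have := hz 0 1; simp at this; linarith
  have hq : ∀ s t : ℝ, 0 ≤ a * s^2 + d * t^2 * normSq k - 2 * s * t * normSq k := by
    intro s t
    have := hz s (t * k)
    have e : L * (normSq (s:ℂ) + normSq (t * k)) - (normSq (m 0 0 * s + m 0 1 * (t * k)) + normSq (m 1 0 * s + m 1 1 * (t * k)))
      = a * s^2 + d * t^2 * normSq k - 2 * s * t * normSq k := by
      rw [ha, hd, hk]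
      simp [normSq_apply]
      ring
    linarith
  have hdet : normSq k ≤ a * d := by
    rcases hd0.eq_or_lt with h0 | h0
    · rw [← h0] at hq ⊢
      have := hq 1 (a+1)
      have hk0 := normSq_nonneg k
      by_contra hc
      have hk1 : 0 < normSq k := by linarith
      have := hq 1 ((a+1)/normSq k)
      have e5 : 2 * 1 * ((a+1)/normSq k) * normSq k = 2 * (a+1) := by field_simp
      rw [e5] at this
      linarith
    · have := hq d 1
      nlinarith [hq d 1]
  refine ⟨by linarith, ?_⟩
  have e : a * d - normSq k = L^2 - L * (normSq (m 0 0) + normSq (m 0 1) + normSq (m 1 0) + normSq (m 1 1)) +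
      normSq (m 0 0 * m 1 1 - m 0 1 * m 1 0) := by
    rw [ha, hd, hk]
    simp [normSq_apply]
    ring
  linarith

def nrm (a : Fin 2 → Fin 2 → ℂ) : ℝ := Complex.normSq (a 0 0) + Complex.normSq (a 0 1) + Complex.normSq (a 1 0) + Complex.normSq (a 1 1)

def ip (a b : Fin 2 → Fin 2 → ℂ) : ℂ := star (a 0 0) * b 0 0 + star (a 0 1) * b 0 1 + star (a 1 0) * b 1 0 + star (a 1 1) * b 1 1

def Bd (L : ℝ) (a b : Fin 2 → Fin 2 → ℂ) : Prop :=
  ∀ x0 x1 y0 y1 z0 z1 : ℂ, Complex.normSq (x0 * (y0 * (a 0 0 * z0 + a 0 1 * z1) + y1 * (a 1 0 * z0 + a 1 1 * z1)) +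
    x1 * (y0 * (b 0 0 * z0 + b 0 1 * z1) + y1 * (b 1 0 * z0 + b 1 1 * z1))) ≤
    L * (Complex.normSq x0 + Complex.normSq x1) * (Complex.normSq y0 + Complex.normSq y1) * (Complex.normSq z0 + Complex.normSq z1)

lemma nrm_nonneg (a) : 0 ≤ nrm a := by
  unfold nrm
  have := Complex.normSq_nonneg
  have := this (a 0 0); have := Complex.normSq_nonneg (a 0 1)
  have := Complex.normSq_nonneg (a 1 0); have := Complex.normSq_nonneg (a 1 1)
  linarith

open Complex in
lemma ip_self (a) : ip a a = (nrm a : ℂ) := by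
  unfold ip nrm
  simp only [star_def, ← normSq_eq_conj_mul_self]; push_cast; rfl

lemma ip_comm (a b) : ip b a = star (ip a b) := by
  unfold ip; simp; ring

open Complex in
lemma bessel (v a b : Fin 2 → Fin 2 → ℂ) (h : ip a b = 0) :
    nrm b * normSq (ip a v) + nrm a * normSq (ip b v) ≤ nrm a * nrm b * nrm v := by
  have hpq : 0 ≤ nrm a * nrm b := mul_nonneg (nrm_nonneg _) (nrm_nonneg _)
  set p := nrm a with hp
  set q := nrm b with hq
  set α := ip a v with hα
  set β := ip b v with hβ
  have hva : ip v a = star α := ip_comm _ _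
  have hvb : ip v b = star β := ip_comm _ _
  have hba : ip b a = 0 := by rw [ip_comm, h, star_zero]
  have key : ip (fun i j => p*q * v i j - q * α * a i j - p * β * b i j) (fun i j => p*q * v i j - q * α * a i j - p * β * b i j)
    = p*q*(p*q*nrm v - q * normSq α - p * normSq β) := by
    have : ip (fun i j => p*q * v i j - q * α * a i j - p * β * b i j) (fun i j => p*q * v i j - q * α * a i j - p * β * b i j)
      = p*q*p*q*ip v v - p*q*q*α*ip v a - p*q*p*β*ip v b - q*star α*p*q*ip a v + q*star α*q*α*ip a a + q*star α*p*β* ip a b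
        - p*star β*p*q*ip b v + p*star β*q*α*ip b a + p*star β*p*β*ip b b := by
      unfold ip; simp; ring
    rw [this, hva, hvb, h, hba, ip_self, ip_self, ip_self, ← hp, ← hq, ← hα, ← hβ]
    rw [← mul_conj, ← mul_conj]
    simp only [star_def]; ring
  rw [ip_self] at key
  have key2 : nrm (fun i j => p*q * v i j - q * α * a i j - p * β * b i j) = p*q*(p*q*nrm v - q * normSq α - p * normSq β) := by
    exact_mod_cast key
  have h3 := nrm_nonneg (fun i j => p*q * v i j - q * α * a i j - p * β * b i j)
  rw [key2] at h3
  rcases hpq.eq_or_lt with h0 | h0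
  · have hz : ∀ c : Fin 2 → Fin 2 → ℂ, nrm c = 0 → ∀ i j, c i j = 0 := by
      intro c hc
      unfold nrm at hc
      have h1 := normSq_nonneg (c 0 0)
      have h2 := normSq_nonneg (c 0 1)
      have h3 := normSq_nonneg (c 1 0)
      have h4 := normSq_nonneg (c 1 1)
      intro i j
      apply normSq_eq_zero.1
      fin_cases i <;> fin_cases j <;> dsimp <;> linarith
    rw [← h0]
    rcases mul_eq_zero.1 h0.symm with h1 | h1
    · have := hz a h1
      have : α = 0 := by rw [hα]; unfold ip; simp [this]
      rw [this, h1]; simp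
    · have := hz b h1
      have : β = 0 := by rw [hβ]; unfold ip; simp [this]
      rw [this, h1]; simp
  · have := nonneg_of_mul_nonneg_right h3 h0
    linarith

open Complex in
lemma three_ortho (L : ℝ) (hL : 0 ≤ L) (a b) (h : Bd L a b) (h1 : nrm a + nrm b = 1) (ho : ip a b = 0)
    (hle : nrm b ≤ nrm a) : 4/9 ≤ L := by
  by_contra hlt
  push Not at hlt
  -- adjugate-conjugate of a
  set ta : Fin 2 → Fin 2 → ℂ := ![![star (a 1 1), - star (a 1 0)], ![- star (a 0 1), star (a 0 0)]] with hta
  set tb : Fin 2 → Fin 2 → ℂ := ![![star (b 1 1), - star (b 1 0)], ![- star (b 0 1), star (b 0 0)]] with htb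
  have nta : nrm ta = nrm a := by simp [nrm, hta]; ring
  have ntb : nrm tb = nrm b := by simp [nrm, htb]; ring
  have hB1 := bessel ta a b ho
  have hB2 := bessel tb b a (by rw [ip_comm, ho, star_zero])
  rw [nta] at hB1
  rw [ntb] at hB2
  have es0 : ip a ta = star (2 * (a 0 0 * a 1 1 - a 0 1 * a 1 0)) := by
    simp [ip, hta]; ring
  have es1 : ip b ta = star (a 0 0 * b 1 1 + b 0 0 * a 1 1 - a 0 1 * b 1 0 - b 0 1 * a 1 0) := by
    simp [ip, hta]; ring
  have es2 : ip b tb = star (2 * (b 0 0 * b 1 1 - b 0 1 * b 1 0)) := by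
    simp [ip, htb]; ring
  have hq0 := nrm_nonneg b
  have hall : ∀ x y : ℂ, 0 < normSq x + normSq y →
      nrm a * normSq x + nrm b * normSq y < 8/9 * (normSq x + normSq y) ∧
      16/9 * (normSq x + normSq y) * (nrm a * normSq x + nrm b * normSq y - 4/9 * (normSq x + normSq y)) <
      normSq ((2 * (a 0 0 * a 1 1 - a 0 1 * a 1 0)) * x^2 + 2 * (a 0 0 * b 1 1 + b 0 0 * a 1 1 - a 0 1 * b 1 0 - b 0 1 * a 1 0) * x * y + (2 * (b 0 0 * b 1 1 - b 0 1 * b 1 0)) * y^2) := by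
    intro x y hn
    have hm := mat2 (L * (normSq x + normSq y)) (by positivity) (fun i j => x * a i j + y * b i j) (by
      intro y0 y1 z0 z1
      have := h x y y0 y1 z0 z1
      convert this using 2
      ring)
    have eN : normSq (x * a 0 0 + y * b 0 0) + normSq (x * a 0 1 + y * b 0 1) + normSq (x * a 1 0 + y * b 1 0) + normSq (x * a 1 1 + y * b 1 1) = nrm a * normSq x + nrm b * normSq y := by
      have : ((normSq (x * a 0 0 + y * b 0 0) + normSq (x * a 0 1 + y * b 0 1) + normSq (x * a 1 0 + y * b 1 0) + normSq (x * a 1 1 + y * b 1 1) : ℝ) : ℂ) = ((nrm a * normSq x + nrm b * normSq y : ℝ) : ℂ) := by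
        have hb' : ip b a = 0 := by rw [ip_comm, ho, star_zero]
        have e1 : ip a b = 0 := ho
        unfold ip at hb' e1
        simp only [star_def] at hb' e1
        unfold nrm
        push_cast
        simp only [← mul_conj, map_add, map_mul]
        linear_combination x * (starRingEnd ℂ) y * hb' + (starRingEnd ℂ) x * y * e1
      exact_mod_cast this
    rw [eN] at hm
    have e2 : (2 * (a 0 0 * a 1 1 - a 0 1 * a 1 0)) * x^2 + 2 * (a 0 0 * b 1 1 + b 0 0 * a 1 1 - a 0 1 * b 1 0 - b 0 1 * a 1 0) * x * y + (2 * (b 0 0 * b 1 1 - b 0 1 * b 1 0)) * y^2 = 2 * ((x * a 0 0 + y * b 0 0) * (x * a 1 1 + y * b 1 1) - (x * a 0 1 + y * b 0 1) * (x * a 1 0 + y * b 1 0)) := by ring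
    rw [e2, normSq_mul]
    have h2' : normSq (2:ℂ) = 4 := by norm_num [normSq_apply]
    rw [h2']
    obtain ⟨hA, hB⟩ := hm
    generalize normSq x + normSq y = n at *
    generalize nrm a * normSq x + nrm b * normSq y = N at *
    have hln : L * n < 4/9 * n := by nlinarith
    refine ⟨by linarith, ?_⟩
    generalize L * n = l at *
    nlinarith
  refine core (nrm a) (nrm b) _ _ _ h1 hle hq0 ?_ ?_ hall
  · have : 0 ≤ nrm a * normSq (ip b tb) := mul_nonneg (nrm_nonneg _) (normSq_nonneg _)
    have hb2 := hB2
    rw [es2, star_def, normSq_conj] at hb2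
    have : 0 ≤ nrm b * normSq (ip a tb) := mul_nonneg (nrm_nonneg _) (normSq_nonneg _)
    have hpa : 0 < nrm a := by linarith
    refine le_of_mul_le_mul_left (?_ : nrm a * _ ≤ nrm a * _) hpa
    nlinarith
  · rw [es0, es1, star_def, normSq_conj, normSq_conj] at hB1
    linarith

open Complex in
lemma three_unit (L : ℝ) (hL : 0 ≤ L) (a b) (h : Bd L a b) (h1 : nrm a + nrm b = 1) : 4/9 ≤ L := by
  obtain ⟨X, Y, hn, hr⟩ := root_unit (2 * ip a b) (nrm b - nrm a) (-2 * ip b a)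
  set a' : Fin 2 → Fin 2 → ℂ := fun i j => star X * a i j + star Y * b i j with ha'
  set b' : Fin 2 → Fin 2 → ℂ := fun i j => - Y * a i j + X * b i j with hb'
  have ho : ip a' b' = 0 := by
    have : ip a' b' = X^2 * ip a b + X * Y * (ip b b - ip a a) - Y^2 * ip b a := by
      simp [ip, ha', hb']; ring
    rw [this, ip_self, ip_self]
    linear_combination (1/2) * hr
  have hnn : nrm a' + nrm b' = 1 := by
    rw [← h1]
    have : nrm a' + nrm b' = (normSq X + normSq Y) * (nrm a + nrm b) := by
      simp [nrm, ha', hb', normSq_apply]; ring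
    rw [this, hn, one_mul]
  have hbd : Bd L a' b' := by
    intro x0 x1 y0 y1 z0 z1
    have := h (x0 * star X - x1 * Y) (x0 * star Y + x1 * X) y0 y1 z0 z1
    have e : normSq (x0 * star X - x1 * Y) + normSq (x0 * star Y + x1 * X) = normSq x0 + normSq x1 := by
      have : normSq (x0 * star X - x1 * Y) + normSq (x0 * star Y + x1 * X) = (normSq x0 + normSq x1) * (normSq X + normSq Y) := by
        simp [normSq_apply]; ring
      rw [this, hn, mul_one]
    rw [e] at this
    convert this using 2
    simp [ha', hb']; ring
  rcases le_total (nrm b') (nrm a') with hle | hle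
  · exact three_ortho L hL a' b' hbd hnn ho hle
  · refine three_ortho L hL b' a' ?_ (by linarith) (by rw [ip_comm, ho, star_zero]) hle
    intro x0 x1 y0 y1 z0 z1
    have := hbd x1 x0 y0 y1 z0 z1
    rw [add_comm (normSq x0)]
    convert this using 2
    ring

open Complex in
lemma three (L : ℝ) (hL : 0 ≤ L) (a b) (h : Bd L a b) : 4/9 * (nrm a + nrm b) ≤ L := by
  rcases (add_nonneg (nrm_nonneg a) (nrm_nonneg b)).eq_or_lt with h0 | h0
  · rw [← h0]; simpa using hL
  set n := nrm a + nrm b with hn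
  set r := (Real.sqrt n)⁻¹ with hr
  have hrr : r * r = n⁻¹ := by rw [hr, ← mul_inv, Real.mul_self_sqrt h0.le]
  have := three_unit (L / n) (by positivity) (fun i j => r * a i j) (fun i j => r * b i j) (by
    intro x0 x1 y0 y1 z0 z1
    have h2 := mul_le_mul_of_nonneg_left (h x0 x1 y0 y1 z0 z1) (inv_nonneg.2 h0.le)
    rw [← hrr, ← normSq_ofReal, ← normSq_mul] at h2
    rw [normSq_ofReal, hrr] at h2
    have e1 : n⁻¹ * (L * (normSq x0 + normSq x1) * (normSq y0 + normSq y1) * (normSq z0 + normSq z1)) =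
        L / n * (normSq x0 + normSq x1) * (normSq y0 + normSq y1) * (normSq z0 + normSq z1) := by
      rw [div_eq_inv_mul]; ring
    rw [e1] at h2
    refine le_of_eq_of_le ?_ h2
    congr 1; ring) (by
    have : nrm (fun i j => r * a i j) + nrm (fun i j => r * b i j) = (r*r) * n := by
      simp only [nrm, normSq_mul, normSq_ofReal, hn]; ring
    rw [this, hrr, inv_mul_cancel₀ h0.ne'])
  rwa [le_div_iff₀ h0] at this

open Complex

lemma sum_cons2 {M : Type*} [AddCommMonoid M] {n : ℕ} (F : (Fin (n+1) → Fin 2) → M) :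
    ∑ i, F i = ∑ i : Fin n → Fin 2, F (Fin.cons 0 i) + ∑ i : Fin n → Fin 2, F (Fin.cons 1 i) := by
  rw [← (Fin.consEquiv (fun _ : Fin (n+1) => Fin 2)).sum_comp, Fintype.sum_prod_type, Fin.sum_univ_two]
  rfl

lemma sum4 {M : Type*} [AddCommMonoid M] (F : (Fin 4 → Fin 2) → M) :
    ∑ i, F i = ∑ a, ∑ b, ∑ c, ∑ d, F ![a,b,c,d] := by
  simp only [sum_cons2, Fin.sum_univ_two, Finset.univ_unique, Finset.sum_singleton]
  simp only [← add_assoc]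
  rfl

lemma vnorm_nonneg {k : ℕ} (x : Fin k → ℂ) : 0 ≤ vnorm x := Real.sqrt_nonneg _

lemma vnorm_sq (x : Fin 2 → ℂ) : vnorm x ^ 2 = normSq (x 0) + normSq (x 1) := by
  unfold vnorm
  rw [Real.sq_sqrt (by positivity), Fin.sum_univ_two, normSq_eq_norm_sq, normSq_eq_norm_sq]

lemma vnorm_smul {k : ℕ} (c : ℂ) (x : Fin k → ℂ) : vnorm (c • x) = ‖c‖ * vnorm x := by
  unfold vnorm
  simp only [Pi.smul_apply, smul_eq_mul, norm_mul, mul_pow, ← Finset.mul_sum]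
  rw [Real.sqrt_mul (by positivity), Real.sqrt_sq (norm_nonneg _)]

lemma rankOne_smul {d n : ℕ} (c : Fin d → ℂ) (u : Fin d → Fin n → ℂ) :
    rankOne (fun j => c j • u j) = (∏ j, c j) • rankOne u := by
  funext i
  simp [rankOne, Finset.prod_mul_distrib]

lemma tinner_smul_right {d n : ℕ} (T X : (Fin d → Fin n) → ℂ) (c : ℂ) :
    tinner T (c • X) = star c * tinner T X := by
  simp only [tinner, Finset.mul_sum]
  refine Finset.sum_congr rfl fun i _ => ?_
  simp; ring

lemma unit_decomp (x : Fin 2 → ℂ) : ∃ u : Fin 2 → ℂ, vnorm u = 1 ∧ x = (vnorm x : ℂ) • u := by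
  by_cases h : vnorm x = 0
  · refine ⟨![1,0], by simp [vnorm], ?_⟩
    have := vnorm_sq x
    rw [h] at this
    have h0 := normSq_nonneg (x 0)
    have h1 := normSq_nonneg (x 1)
    have e0 : x 0 = 0 := normSq_eq_zero.1 (by linarith)
    have e1 : x 1 = 0 := normSq_eq_zero.1 (by linarith)
    rw [h]; funext i; fin_cases i <;> simp [e0, e1]
  · refine ⟨((vnorm x)⁻¹ : ℂ) • x, ?_, ?_⟩
    · rw [vnorm_smul, norm_inv, norm_real, Real.norm_of_nonneg (vnorm_nonneg x), inv_mul_cancel₀ h]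
    · rw [smul_smul, mul_inv_cancel₀ (by exact_mod_cast h), one_smul]

lemma homog (T : (Fin 4 → Fin 2) → ℂ) (B : ℝ)
    (h : ∀ x : Fin 4 → Fin 2 → ℂ, (∀ j, vnorm (x j) = 1) → ‖tinner T (rankOne x)‖ ≤ B)
    (x : Fin 4 → Fin 2 → ℂ) : ‖tinner T (rankOne x)‖ ≤ B * ∏ j, vnorm (x j) := by
  choose u hu hx using fun j => unit_decomp (x j)
  have : rankOne x = (∏ j, (vnorm (x j) : ℂ)) • rankOne u := by
    rw [← rankOne_smul]; congr 1; funext j; exact hx j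
  rw [this, tinner_smul_right, norm_mul, norm_star, norm_prod, mul_comm]
  have e : ∏ j, ‖(vnorm (x j) : ℂ)‖ = ∏ j, vnorm (x j) := by
    refine Finset.prod_congr rfl fun j _ => ?_
    rw [norm_real, Real.norm_of_nonneg (vnorm_nonneg _)]
  rw [e]
  exact mul_le_mul_of_nonneg_right (h u hu) (Finset.prod_nonneg fun j _ => vnorm_nonneg _)

lemma hs_sq (T : (Fin 4 → Fin 2) → ℂ) : hsNorm T ^ 2 = ∑ i, ‖T i‖ ^ 2 :=
  Real.sq_sqrt (by positivity)

lemma slice_bd (T : (Fin 4 → Fin 2) → ℂ) (B : ℝ) (hB : 0 ≤ B)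
    (h : ∀ x : Fin 4 → Fin 2 → ℂ, (∀ j, vnorm (x j) = 1) → ‖tinner T (rankOne x)‖ ≤ B) (i : Fin 2) :
    Bd (B^2) (fun j k => T ![i,0,j,k]) (fun j k => T ![i,1,j,k]) := by
  intro x0 x1 y0 y1 z0 z1
  have := homog T B h ![Pi.single i 1, ![star x0, star x1], ![star y0, star y1], ![star z0, star z1]]
  have h2 := pow_le_pow_left₀ (norm_nonneg _) this 2
  rw [mul_pow, ← Finset.prod_pow, ← normSq_eq_norm_sq] at h2
  simp only [Fin.prod_univ_four, vnorm_sq] at h2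
  have e1 : normSq ((Pi.single i 1 : Fin 2 → ℂ) 0) + normSq ((Pi.single i 1 : Fin 2 → ℂ) 1) = 1 := by
    fin_cases i <;> simp
  refine le_of_eq_of_le ?_ (h2.trans_eq ?_)
  · congr 1
    simp only [tinner, sum4, rankOne, Fin.prod_univ_four, Fin.sum_univ_two]
    fin_cases i <;> simp <;> ring
  · simp [e1]; ring

lemma lower (T : (Fin 4 → Fin 2) → ℂ) (B : ℝ) (hB : 0 ≤ B)
    (h : ∀ x : Fin 4 → Fin 2 → ℂ, (∀ j, vnorm (x j) = 1) → ‖tinner T (rankOne x)‖ ≤ B) :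
    2/9 * hsNorm T ^ 2 ≤ B ^ 2 := by
  have h0 := three _ (by positivity) _ _ (slice_bd T B hB h 0)
  have h1 := three _ (by positivity) _ _ (slice_bd T B hB h 1)
  rw [hs_sq, sum4]
  simp only [nrm, normSq_eq_norm_sq, Fin.sum_univ_two] at *
  linarith

lemma real_W (B0 B1 C0 C1 D0 D1 : ℝ) (hB : B0^2+B1^2=1) (hC : C0^2+C1^2=1) (hD : D0^2+D1^2=1) :
    (B0*C1*D1 + B1*C0*D1 + B1*C1*D0)^2 ≤ 4/3 := by
  have h1 : (B0*C1*D1 + B1*C0*D1 + B1*C1*D0)^2 ≤ (B1*C1)^2 + (B0*C1+B1*C0)^2 := by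
    have e : (B1*C1)^2 + (B0*C1+B1*C0)^2 = ((B1*C1)^2 + (B0*C1+B1*C0)^2) * (D0^2+D1^2) := by rw [hD, mul_one]
    rw [e]
    nlinarith [sq_nonneg (B1*C1*D1 - (B0*C1+B1*C0)*D0)]
  have hs : B1^2 ≤ 1 := by nlinarith
  have h2 : (4/3 - B1^2) * ((B1*C1)^2 + (B0*C1+B1*C0)^2) ≤ (4/3 - B1^2) * (4/3) := by
    have e : (4/3 - B1^2) * (4/3) - (4/3 - B1^2) * ((B1*C1)^2 + (B0*C1+B1*C0)^2) =
      ((4/3-B1^2)*C0 - B0*B1*C1)^2 + (B1^2-2/3)^2*C1^2 := by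
      have hB0 : B0^2 = 1 - B1^2 := by linarith
      have hC0 : C0^2 = 1 - C1^2 := by linarith
      ring_nf
      simp only [hB0, hC0]
      ring
    nlinarith [sq_nonneg ((4/3-B1^2)*C0 - B0*B1*C1), sq_nonneg ((B1^2-2/3)*C1)]
  have := le_of_mul_le_mul_left h2 (by linarith)
  linarith

lemma om_norm : ‖om‖ = 1 := by
  have : om = exp ((2 * Real.pi / 3 : ℝ) * I) := by unfold om; congr 1; push_cast; ring
  rw [this, norm_exp_ofReal_mul_I]

lemma om_sum : 1 + om + om^2 = 0 := by
  have := (Complex.isPrimitiveRoot_exp 3 (by norm_num)).geom_sum_eq_zero (by norm_num)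
  simp only [Finset.sum_range_succ, Finset.sum_range_zero] at this
  unfold om
  push_cast at this
  linear_combination this

lemma complex_W (b0 b1 c0 c1 d0 d1 : ℂ) (hb : normSq b0 + normSq b1 = 1) (hc : normSq c0 + normSq c1 = 1)
    (hd : normSq d0 + normSq d1 = 1) :
    ‖b0*c1*d1 + om * (b1*c0*d1) + om^2*(b1*c1*d0)‖^2 ≤ 4/3 := by
  simp only [normSq_eq_norm_sq] at *
  have h := norm_add₃_le (a := b0*c1*d1) (b := om * (b1*c0*d1)) (c := om^2*(b1*c1*d0))
  simp only [norm_mul, norm_pow, om_norm, one_mul, one_pow] at h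
  exact (pow_le_pow_left₀ (norm_nonneg _) h 2).trans (real_W _ _ _ _ _ _ hb hc hd)

lemma m4core (a0 a1 b0 b1 c0 c1 d0 d1 : ℂ) (ha : normSq a0 + normSq a1 = 1) (hb : normSq b0 + normSq b1 = 1)
    (hc : normSq c0 + normSq c1 = 1) (hd : normSq d0 + normSq d1 = 1) :
    ‖a0*b0*c1*d1 + a1*b1*c0*d0 + om*(a1*b0*c1*d0 + a0*b1*c0*d1) + om^2*(a1*b0*c0*d1+a0*b1*c1*d0)‖^2 ≤ 4/3 := by
  have hu : ∀ x0 x1 : ℂ, normSq x0 + normSq x1 = 1 →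
      normSq (star a0 * x0 + star a1 * x1) + normSq (a0 * x1 - a1 * x0) = 1 := by
    intro x0 x1 hx
    have : normSq (star a0 * x0 + star a1 * x1) + normSq (a0 * x1 - a1 * x0) =
      (normSq a0 + normSq a1) * (normSq x0 + normSq x1) := by
      simp [normSq_apply]; ring
    rw [this, ha, hx, mul_one]
  have h := complex_W _ _ _ _ _ _ (hu b0 b1 hb) (hu c0 c1 hc) (hu d0 d1 hd)
  have ha' : a0 * star a0 + a1 * star a1 = 1 := by
    rw [star_def, mul_conj, mul_conj]; exact_mod_cast ha
  refine le_of_eq_of_le ?_ h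
  congr 2
  have ho : om^2 = -1 - om := by linear_combination om_sum
  rw [ho]
  linear_combination (-(a0*b0*c1*d1 + a1*b1*c0*d0 + om*(a1*b0*c1*d0 + a0*b1*c0*d1) + (-1-om)*(a1*b0*c0*d1+a0*b1*c1*d0))) * ha'

lemma m4_eval (x : Fin 4 → Fin 2 → ℂ) : tinner M4 (rankOne x) =
    (star (x 0 0)*star (x 1 0)*star (x 2 1)*star (x 3 1) + star (x 0 1)*star (x 1 1)*star (x 2 0)*star (x 3 0)
    + om*(star (x 0 1)*star (x 1 0)*star (x 2 1)*star (x 3 0) + star (x 0 0)*star (x 1 1)*star (x 2 0)*star (x 3 1))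
    + om^2*(star (x 0 1)*star (x 1 0)*star (x 2 0)*star (x 3 1)+star (x 0 0)*star (x 1 1)*star (x 2 1)*star (x 3 0)))
    / (Real.sqrt 6 : ℂ) := by
  simp [tinner, sum4, rankOne, Fin.prod_univ_four, Fin.sum_univ_two, M4]
  ring

lemma sqrt_two_ninths : (Real.sqrt 2 / 3)^2 = 2/9 := by
  rw [div_pow, Real.sq_sqrt (by norm_num)]; norm_num

lemma m4_upper (x : Fin 4 → Fin 2 → ℂ) (hx : ∀ j, vnorm (x j) = 1) :
    ‖tinner M4 (rankOne x)‖ ≤ Real.sqrt 2 / 3 := by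
  refine le_of_sq_le_sq ?_ (by positivity)
  rw [sqrt_two_ninths, m4_eval, norm_div, div_pow, norm_real, Real.norm_of_nonneg (Real.sqrt_nonneg _), Real.sq_sqrt (by norm_num)]
  have hu : ∀ j, normSq (star (x j 0)) + normSq (star (x j 1)) = 1 := by
    intro j
    rw [star_def, normSq_conj, normSq_conj, ← vnorm_sq, hx]; norm_num
  have := m4core _ _ _ _ _ _ _ _ (hu 0) (hu 1) (hu 2) (hu 3)
  linarith

lemma m4_hs : hsNorm M4 = 1 := by
  have : hsNorm M4 ^ 2 = 1 := by
    rw [hs_sq, sum4]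
    simp only [M4, Fin.sum_univ_two, norm_div, norm_real, Real.norm_of_nonneg (Real.sqrt_nonneg 6), div_pow, Real.sq_sqrt (show (0:ℝ) ≤ 6 by norm_num)]
    simp [om_norm]
    norm_num
  have h0 : 0 ≤ hsNorm M4 := Real.sqrt_nonneg _
  nlinarith

lemma hs_nonneg (T : (Fin 4 → Fin 2) → ℂ) : 0 ≤ hsNorm T := Real.sqrt_nonneg _

lemma rankOne_hs (x : Fin 4 → Fin 2 → ℂ) : ∑ i, ‖rankOne x i‖^2 = ∏ j, vnorm (x j) ^ 2 := by
  simp only [rankOne, sum4, Fin.sum_univ_two, Fin.prod_univ_four, vnorm_sq, normSq_eq_norm_sq, norm_mul]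
  simp
  ring

lemma hs_sub_sq (T X : (Fin 4 → Fin 2) → ℂ) (c : ℂ) :
    hsNorm (T - c • X)^2 = hsNorm T ^2 - 2 * (star c * tinner T X).re + ‖c‖^2 * ∑ i, ‖X i‖^2 := by
  rw [← tinner_smul_right, hs_sq, hs_sq, Finset.mul_sum, tinner, Complex.re_sum, Finset.mul_sum,
    ← Finset.sum_sub_distrib, ← Finset.sum_add_distrib]
  refine Finset.sum_congr rfl fun i _ => ?_
  rw [← mul_pow, ← norm_mul]
  simp only [Pi.sub_apply, Pi.smul_apply, smul_eq_mul]
  generalize T i = u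
  generalize c * X i = v
  simp only [← normSq_eq_norm_sq, normSq_apply]
  simp; ring

lemma spec_bdd (T : (Fin 4 → Fin 2) → ℂ) : BddAbove {r : ℝ | ∃ x : Fin 4 → Fin 2 → ℂ, (∀ j, vnorm (x j) = 1) ∧
    r = ‖tinner T (rankOne x)‖} := by
  refine ⟨∑ i, ‖T i‖, ?_⟩
  rintro r ⟨x, hx, rfl⟩
  refine (norm_sum_le _ _).trans (Finset.sum_le_sum fun i _ => ?_)
  rw [norm_mul, RCLike.norm_conj, rankOne, norm_prod]
  refine mul_le_of_le_one_right (norm_nonneg _) (Finset.prod_le_one (fun _ _ => norm_nonneg _) fun j _ => ?_)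
  have h := vnorm_sq (x j)
  rw [hx, normSq_eq_norm_sq, normSq_eq_norm_sq] at h
  generalize i j = k
  fin_cases k <;> dsimp <;> nlinarith [norm_nonneg (x j 0), norm_nonneg (x j 1)]

lemma spec_ne (T : (Fin 4 → Fin 2) → ℂ) : {r : ℝ | ∃ x : Fin 4 → Fin 2 → ℂ, (∀ j, vnorm (x j) = 1) ∧
    r = ‖tinner T (rankOne x)‖}.Nonempty :=
  ⟨_, fun _ => ![1,0], fun _ => by simp [vnorm], rfl⟩

lemma spec_lower (T : (Fin 4 → Fin 2) → ℂ) (hT : hsNorm T = 1) : Real.sqrt 2 / 3 ≤ specNorm T := by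
  have h0 : ∀ x : Fin 4 → Fin 2 → ℂ, (∀ j, vnorm (x j) = 1) → ‖tinner T (rankOne x)‖ ≤ specNorm T :=
    fun x hx => le_csSup (spec_bdd T) ⟨x, hx, rfl⟩
  have hp : 0 ≤ specNorm T := by
    obtain ⟨r, x, hx, hr⟩ := spec_ne T
    exact (norm_nonneg _).trans (h0 x hx)
  have := lower T _ hp h0
  rw [hT] at this
  refine le_of_sq_le_sq ?_ hp
  rw [sqrt_two_ninths]; linarith

lemma m4_spec : specNorm M4 = Real.sqrt 2 / 3 := by
  refine le_antisymm (csSup_le (spec_ne M4) ?_) (spec_lower M4 m4_hs)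
  rintro r ⟨x, hx, rfl⟩
  exact m4_upper x hx

lemma beta_eq : betaN ℂ 4 2 = Real.sqrt 2 / 3 := by
  have hlb : ∀ r ∈ {r : ℝ | ∃ T : (Fin 4 → Fin 2) → ℂ, hsNorm T = 1 ∧ r = specNorm T}, Real.sqrt 2 / 3 ≤ r := by
    rintro r ⟨T, hT, rfl⟩; exact spec_lower T hT
  exact le_antisymm (csInf_le ⟨_, hlb⟩ ⟨M4, m4_hs, m4_spec.symm⟩) (le_csInf ⟨_, M4, m4_hs, rfl⟩ hlb)

lemma nuc_bdd (T : (Fin 4 → Fin 2) → ℂ) : BddBelow {r : ℝ | ∃ (m : ℕ) (x : Fin m → Fin 4 → Fin 2 → ℂ),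
    T = (∑ i, rankOne (x i)) ∧ r = ∑ i, ∏ j, vnorm (x i j)} := by
  refine ⟨0, ?_⟩
  rintro r ⟨m, x, -, rfl⟩
  exact Finset.sum_nonneg fun i _ => Finset.prod_nonneg fun j _ => vnorm_nonneg _

lemma nuc_le {ι : Type} [Fintype ι] (x : ι → Fin 4 → Fin 2 → ℂ) :
    nucNorm (∑ i, rankOne (x i)) ≤ ∑ i, ∏ j, vnorm (x i j) := by
  refine csInf_le (nuc_bdd _) ⟨Fintype.card ι, fun k => x ((Fintype.equivFin ι).symm k), ?_, ?_⟩
  · exact ((Fintype.equivFin ι).symm.sum_comp (fun i => rankOne (x i))).symm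
  · exact ((Fintype.equivFin ι).symm.sum_comp (fun i => ∏ j, vnorm (x i j))).symm

lemma scale0 (c : ℂ) (x : Fin 4 → Fin 2 → ℂ) : ∃ y : Fin 4 → Fin 2 → ℂ, rankOne y = c • rankOne x ∧
    ∏ j, vnorm (y j) = ‖c‖ * ∏ j, vnorm (x j) := by
  refine ⟨fun j => (![c,1,1,1] : Fin 4 → ℂ) j • x j, ?_, ?_⟩
  · rw [rankOne_smul]; simp [Fin.prod_univ_four]
  · simp only [vnorm_smul, Finset.prod_mul_distrib]; simp [Fin.prod_univ_four]

lemma basis_decomp (T : (Fin 4 → Fin 2) → ℂ) : ∃ x : (Fin 4 → Fin 2) → Fin 4 → Fin 2 → ℂ,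
    T = ∑ i, rankOne (x i) ∧ ∀ i, ∏ j, vnorm (x i j) = ‖T i‖ := by
  choose y hy hy' using fun i => scale0 (T i) (fun j => Pi.single (i j) (1:ℂ))
  refine ⟨y, ?_, ?_⟩
  · funext k
    simp only [hy, Finset.sum_apply, Pi.smul_apply, smul_eq_mul]
    rw [Finset.sum_eq_single k]
    · simp [rankOne]
    · intro i _ hik
      obtain ⟨j, hj⟩ := Function.ne_iff.1 hik
      have : rankOne (fun j => Pi.single (i j) (1:ℂ)) k = 0 :=
        Finset.prod_eq_zero (Finset.mem_univ j) (Pi.single_eq_of_ne hj.symm _)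
      rw [this, mul_zero]
    · simp
  · intro i
    rw [hy']
    have : ∀ j, vnorm (Pi.single (i j) (1:ℂ) : Fin 2 → ℂ) = 1 := by
      intro j
      generalize i j = k
      fin_cases k <;> simp [vnorm]
    simp [this]

lemma nuc_ne (T : (Fin 4 → Fin 2) → ℂ) : {r : ℝ | ∃ (m : ℕ) (x : Fin m → Fin 4 → Fin 2 → ℂ),
    T = (∑ i, rankOne (x i)) ∧ r = ∑ i, ∏ j, vnorm (x i j)}.Nonempty := by
  obtain ⟨x, hx, -⟩ := basis_decomp T
  refine ⟨_, Fintype.card (Fin 4 → Fin 2), fun k => x ((Fintype.equivFin _).symm k), ?_, rfl⟩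
  rw [hx]
  exact ((Fintype.equivFin _).symm.sum_comp (fun i => rankOne (x i))).symm

lemma nuc_add (T : (Fin 4 → Fin 2) → ℂ) (y : Fin 4 → Fin 2 → ℂ) :
    nucNorm (T + rankOne y) ≤ nucNorm T + ∏ j, vnorm (y j) := by
  rw [← sub_le_iff_le_add]
  refine le_csInf (nuc_ne T) ?_
  rintro r ⟨m, x, hT, rfl⟩
  rw [sub_le_iff_le_add]
  have := nuc_le (fun o : Option (Fin m) => o.elim y x)
  rw [Fintype.sum_option, Fintype.sum_option] at this
  simp only [Option.elim] at this
  rw [hT, add_comm, add_comm (∑ i, ∏ j, vnorm (x i j))]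
  exact this

lemma nuc_smul (T : (Fin 4 → Fin 2) → ℂ) (c : ℝ) (hc : 0 < c) :
    nucNorm ((c:ℂ) • T) ≤ c * nucNorm T := by
  rw [← div_le_iff₀' hc]
  refine le_csInf (nuc_ne T) ?_
  rintro r ⟨m, x, hT, rfl⟩
  rw [div_le_iff₀' hc]
  choose y hy hy' using fun i => scale0 (c:ℂ) (x i)
  have := nuc_le y
  simp only [hy, hy', ← Finset.smul_sum, ← Finset.mul_sum, ← hT] at this
  rwa [norm_real, Real.norm_of_nonneg hc.le] at this

lemma hs_smul (T : (Fin 4 → Fin 2) → ℂ) (c : ℂ) : hsNorm (c • T) = ‖c‖ * hsNorm T := by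
  unfold hsNorm
  simp only [Pi.smul_apply, smul_eq_mul, norm_mul, mul_pow, ← Finset.mul_sum]
  rw [Real.sqrt_mul (by positivity), Real.sqrt_sq (norm_nonneg _)]

lemma alpha_bdd : BddAbove {r : ℝ | ∃ T : (Fin 4 → Fin 2) → ℂ, hsNorm T = 1 ∧ r = nucNorm T} := by
  refine ⟨∑ i : Fin 4 → Fin 2, 1, ?_⟩
  rintro r ⟨T, hT, rfl⟩
  obtain ⟨x, hx, hx'⟩ := basis_decomp T
  have h := nuc_le x
  rw [← hx] at h
  refine h.trans (Finset.sum_le_sum fun i _ => ?_)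
  rw [hx']
  have h2 := hs_sq T
  rw [hT] at h2
  have h3 := Finset.single_le_sum (f := fun i => ‖T i‖^2) (fun i _ => by positivity) (Finset.mem_univ i)
  nlinarith [norm_nonneg (T i)]

lemma m4_nuc : 3 / Real.sqrt 2 ≤ nucNorm M4 := by
  refine le_csInf (nuc_ne M4) ?_
  rintro r ⟨m, x, hT, rfl⟩
  have h1 : tinner M4 M4 = 1 := by
    have := hs_sq M4
    rw [m4_hs] at this
    unfold tinner
    simp only [mul_conj, normSq_eq_norm_sq]
    rw [← ofReal_sum, ← this]; simp
  have h2 : tinner M4 M4 = ∑ i, tinner M4 (rankOne (x i)) := by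
    conv_lhs => rw [show tinner M4 M4 = tinner M4 (∑ i, rankOne (x i)) by rw [← hT]]
    unfold tinner
    rw [Finset.sum_comm]
    refine Finset.sum_congr rfl fun k _ => ?_
    rw [Finset.sum_apply, map_sum, Finset.mul_sum]
  have h3 : (1:ℝ) ≤ ∑ i, Real.sqrt 2 / 3 * ∏ j, vnorm (x i j) := by
    have : ‖(1:ℂ)‖ ≤ ∑ i, ‖tinner M4 (rankOne (x i))‖ := by
      rw [← h1, h2]; exact norm_sum_le _ _
    rw [norm_one] at this
    exact this.trans (Finset.sum_le_sum fun i _ => homog M4 _ m4_upper (x i))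
  rw [← Finset.mul_sum] at h3
  rw [div_le_iff₀ (by positivity)]
  linarith

lemma alpha_upper : alphaN ℂ 4 2 * (Real.sqrt 2 / 3) ≤ 1 := by
  set C := alphaN ℂ 4 2 with hC
  have hCT : ∀ T : (Fin 4 → Fin 2) → ℂ, hsNorm T = 1 → nucNorm T ≤ C :=
    fun T hT => le_csSup alpha_bdd ⟨T, hT, rfl⟩
  have hC0 : 0 < C := lt_of_lt_of_le (by positivity) (m4_nuc.trans (hCT M4 m4_hs))
  have hCT' : ∀ T : (Fin 4 → Fin 2) → ℂ, nucNorm T ≤ C * hsNorm T := by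
    intro T
    rcases (hs_nonneg T).eq_or_lt with h | h
    · obtain ⟨x, hx, hx'⟩ := basis_decomp T
      have h0 := nuc_le x
      rw [← hx] at h0
      have h2 := hs_sq T
      rw [← h] at h2
      have h3 : ∀ i, ‖T i‖ = 0 := by
        intro i
        have h3 := Finset.single_le_sum (f := fun i => ‖T i‖^2) (fun i _ => by positivity) (Finset.mem_univ i)
        nlinarith [norm_nonneg (T i)]
      simp only [hx', h3, Finset.sum_const_zero] at h0
      rw [← h, mul_zero]; exact h0
    · have h1 := hCT (((hsNorm T)⁻¹ : ℂ) • T) (by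
        rw [hs_smul, norm_inv, norm_real, Real.norm_of_nonneg h.le, inv_mul_cancel₀ h.ne'])
      have h2 := nuc_smul (((hsNorm T)⁻¹ : ℂ) • T) (hsNorm T) h
      rw [smul_smul, mul_inv_cancel₀ (by exact_mod_cast h.ne'), one_smul] at h2
      rw [mul_comm]
      exact h2.trans (mul_le_mul_of_nonneg_left h1 h.le)
  have key : ∀ δ : ℝ, 0 < δ → C * (Real.sqrt 2 / 3 - 2 * δ) ≤ 1 := by
    intro δ hδ
    have hstep : ∀ T : (Fin 4 → Fin 2) → ℂ, hsNorm T = 1 →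
        nucNorm T ≤ C * (1 - 2*δ * (Real.sqrt 2 / 3 - δ) + 2 * δ^2) + 2 * δ := by
      intro T hT
      obtain ⟨r, ⟨x, hx, rfl⟩, hr⟩ := exists_lt_of_lt_csSup (spec_ne T)
        (show Real.sqrt 2 / 3 - δ < specNorm T by linarith [spec_lower T hT])
      -- a phase
      obtain ⟨θ, hθ, hθ'⟩ : ∃ θ : ℂ, ‖θ‖ = 1 ∧ star θ * tinner T (rankOne x) = (‖tinner T (rankOne x)‖ : ℂ) := by
        generalize tinner T (rankOne x) = z
        refine ⟨exp (arg z * I), norm_exp_ofReal_mul_I _, ?_⟩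
        nth_rewrite 2 [← norm_mul_exp_arg_mul_I z]
        have : star (exp (arg z * I)) * exp (arg z * I) = 1 := by
          rw [star_def, ← normSq_eq_conj_mul_self, normSq_eq_norm_sq, norm_exp_ofReal_mul_I]; simp
        linear_combination (‖z‖ : ℂ) * this
      obtain ⟨y, hy, hy'⟩ := scale0 (((2*δ : ℝ) : ℂ) * θ) x
      have hcn : ‖((2*δ : ℝ) : ℂ) * θ‖ = 2*δ := by
        rw [norm_mul, hθ, norm_real, Real.norm_of_nonneg (by positivity), mul_one]
      have hs := hs_sub_sq T (rankOne x) (((2*δ : ℝ) : ℂ) * θ)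
      rw [rankOne_hs, hcn, hT, star_mul', mul_assoc, hθ', star_def, conj_ofReal, ← ofReal_mul, ofReal_re] at hs
      simp only [hx, one_pow, Finset.prod_const_one] at hs hy'
      rw [← hy] at hs
      rw [hcn] at hy'
      have hadd := nuc_add (T - rankOne y) y
      rw [sub_add_cancel, hy'] at hadd
      have h1 := hCT' (T - rankOne y)
      have h2 : hsNorm (T - rankOne y) ≤ 1 - 2*δ * (Real.sqrt 2 / 3 - δ) + 2 * δ^2 := by
        have := mul_lt_mul_of_pos_left hr hδ
        nlinarith [sq_nonneg (hsNorm (T - rankOne y) - 1)]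
      have h3 := mul_le_mul_of_nonneg_left h2 hC0.le
      linarith
    have hle : C ≤ C * (1 - 2*δ * (Real.sqrt 2 / 3 - δ) + 2 * δ^2) + 2 * δ := by
      refine csSup_le ⟨_, M4, m4_hs, rfl⟩ ?_
      rintro r ⟨T, hT, rfl⟩
      exact hstep T hT
    refine le_of_mul_le_mul_left (?_ : (2*δ) * _ ≤ (2*δ) * _) (by positivity)
    linarith
  by_contra hc
  push Not at hc
  have := key ((C * (Real.sqrt 2 / 3) - 1) / (4 * C)) (div_pos (by linarith) (by linarith))
  have e : C * (Real.sqrt 2 / 3 - 2 * ((C * (Real.sqrt 2 / 3) - 1) / (4 * C))) = (C * (Real.sqrt 2 / 3) + 1) / 2 := by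
    field_simp; ring
  rw [e] at this
  linarith

lemma alpha_eq : alphaN ℂ 4 2 = 3 / Real.sqrt 2 := by
  refine le_antisymm ?_ (m4_nuc.trans (le_csSup alpha_bdd ⟨M4, m4_hs, rfl⟩))
  rw [le_div_iff₀ (by positivity)]
  linarith [alpha_upper]

/-- `M₄` is a 4-qubit state with `‖M₄‖_∞ = √2/3`; consequently
`β(2^{×4},ℂ) = √2/3` and `α(2^{×4},ℂ) = 3/√2`, and `M₄` attains the minimal spectral
norm, i.e. it is maximally entangled. -/
theorem stmt19 :
    hsNorm M4 = 1 ∧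
    specNorm M4 = Real.sqrt 2 / 3 ∧
    betaN ℂ 4 2 = Real.sqrt 2 / 3 ∧
    alphaN ℂ 4 2 = 3 / Real.sqrt 2 ∧
    specNorm M4 = betaN ℂ 4 2 := by
  exact ⟨m4_hs, m4_spec, beta_eq, alpha_eq, m4_spec.trans beta_eq.symm⟩
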